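/- arXiv:2509.00224 — 5 statements merged into one kernel-verified Lean document; each statement's English description precedes it below -/
import Mathlib

section
/- Let N, r, m, M be positive natural numbers, let V ∈ ℝ^{N×r} and W ∈ ℝ^{N×m} be matrices satisfying VᵀV = I_r, WᵀW = I_m, and VᵀW = 0, let q̄ ∈ ℝ^N, and let q_1, …, q_M ∈ ℝ^N. Define q̂_j = Vᵀ(q_j − q̄) ∈ ℝ^r and p̂_j = Wᵀ(q_j − q̄) ∈ ℝ^m. Then for every function n : ℝ^r → ℝ^m, ∑_{j=1}^M ‖q_j − (q̄ + V Vᵀ(q_j − q̄) + W n(q̂_j))‖₂² = ∑_{j=1}^M ‖p̂_j − n(q̂_j)‖₂² + C, where C = ∑_{j=1}^M ‖(q_j − q̄) − V Vᵀ(q_j − q̄) − W Wᵀ(q_j − q̄)‖₂² does not depend on n. Consequently, for any set S of functions from ℝ^r to ℝ^m and any regularization functional R : S → ℝ, a function n ∈ S minimizes ∑_{j=1}^M ‖q_j − (q̄ + V Vᵀ(q_j − q̄) + W n(q̂_j))‖₂² + R(n) over S if and only if it minimizes ∑_{j=1}^M ‖p̂_j − n(q̂_j)‖₂² + R(n) over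 S. -/
open Matrix

/-- Pythagoras for an orthonormal column matrix `W` and a vector orthogonal to its range. -/
lemma sum_sq_add_mulVec_of_transpose_mulVec_eq_zero {ι κ : Type*} [Fintype ι] [Fintype κ]
    [DecidableEq κ] {W : Matrix ι κ ℝ} (hW : Wᵀ * W = 1) {e : ι → ℝ} (he : Wᵀ *ᵥ e = 0)
    (z : κ → ℝ) :
    ∑ i, (e i + (W *ᵥ z) i) ^ 2 = ∑ k, z k ^ 2 + ∑ i, e i ^ 2 := by
  have cross : e ⬝ᵥ (W *ᵥ z) = 0 := by
    rw [dotProduct_mulVec, ← mulVec_transpose, he, zero_dotProduct]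
  have isometry : (W *ᵥ z) ⬝ᵥ (W *ᵥ z) = z ⬝ᵥ z := by
    rw [dotProduct_mulVec, ← mulVec_transpose, mulVec_mulVec, hW, one_mulVec]
  have expand : (e + W *ᵥ z) ⬝ᵥ (e + W *ᵥ z) = z ⬝ᵥ z + e ⬝ᵥ e := by
    rw [add_dotProduct, dotProduct_add, dotProduct_add, dotProduct_comm (W *ᵥ z) e, cross,
      isometry]
    ring
  simpa only [dotProduct, Pi.add_apply, ← pow_two] using expand

/-- The residual of the projection onto the ranges of `V` and `W` is orthogonal to the range
of `W`. -/
lemma transpose_mulVec_projection_residual {ι κ l : Type*} [Fintype ι] [Fintype κ] [Fintype l]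
    [DecidableEq κ] {V : Matrix ι l ℝ} {W : Matrix ι κ ℝ} (hW : Wᵀ * W = 1)
    (hVW : Vᵀ * W = 0) (x : ι → ℝ) :
    Wᵀ *ᵥ (x - V *ᵥ (Vᵀ *ᵥ x) - W *ᵥ (Wᵀ *ᵥ x)) = 0 := by
  have hWV : Wᵀ * V = 0 := by
    simpa using congrArg transpose hVW
  rw [mulVec_sub, mulVec_sub, mulVec_mulVec _ Wᵀ V, mulVec_mulVec _ Wᵀ W, hWV, hW, zero_mulVec,
    one_mulVec, sub_zero, sub_self]

/-- Equivalence of the full projection-error minimization problem for learning a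
nonlinear augmentation term with the reduced minimization problem in latent
coordinates. -/
theorem stmt1 (N r m M : ℕ) (hN : 0 < N) (hr : 0 < r) (hm : 0 < m) (hM : 0 < M)
    (V : Matrix (Fin N) (Fin r) ℝ) (W : Matrix (Fin N) (Fin m) ℝ)
    (hV : Vᵀ * V = 1) (hW : Wᵀ * W = 1) (hVW : Vᵀ * W = 0)
    (qbar : Fin N → ℝ) (q : Fin M → Fin N → ℝ)
    (qhat : Fin M → Fin r → ℝ) (phat : Fin M → Fin m → ℝ)
    (hqhat : ∀ j, qhat j = Vᵀ *ᵥ (q j - qbar))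
    (hphat : ∀ j, phat j = Wᵀ *ᵥ (q j - qbar)) :
    (∀ n : (Fin r → ℝ) → (Fin m → ℝ),
      ∑ j, ∑ i, (q j i - (qbar + V *ᵥ (Vᵀ *ᵥ (q j - qbar)) + W *ᵥ n (qhat j)) i) ^ 2
        = (∑ j, ∑ i, (phat j i - n (qhat j) i) ^ 2)
          + ∑ j, ∑ i, ((q j - qbar) i - (V *ᵥ (Vᵀ *ᵥ (q j - qbar))) i
              - (W *ᵥ (Wᵀ *ᵥ (q j - qbar))) i) ^ 2)
    ∧ ∀ (S : Set ((Fin r → ℝ) → (Fin m → ℝ)))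
        (R : ((Fin r → ℝ) → (Fin m → ℝ)) → ℝ),
        ∀ n ∈ S,
          ((∀ n' ∈ S,
              (∑ j, ∑ i, (q j i - (qbar + V *ᵥ (Vᵀ *ᵥ (q j - qbar))
                  + W *ᵥ n (qhat j)) i) ^ 2) + R n
                ≤ (∑ j, ∑ i, (q j i - (qbar + V *ᵥ (Vᵀ *ᵥ (q j - qbar))
                  + W *ᵥ n' (qhat j)) i) ^ 2) + R n')
            ↔ (∀ n' ∈ S,
              (∑ j, ∑ i, (phat j i - n (qhat j) i) ^ 2) + R n
                ≤ (∑ j, ∑ i, (phat j i - n' (qhat j) i) ^ 2) + R n')) := by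
  have key : ∀ n : (Fin r → ℝ) → (Fin m → ℝ),
      ∑ j, ∑ i, (q j i - (qbar + V *ᵥ (Vᵀ *ᵥ (q j - qbar)) + W *ᵥ n (qhat j)) i) ^ 2
        = (∑ j, ∑ i, (phat j i - n (qhat j) i) ^ 2)
          + ∑ j, ∑ i, ((q j - qbar) i - (V *ᵥ (Vᵀ *ᵥ (q j - qbar))) i
              - (W *ᵥ (Wᵀ *ᵥ (q j - qbar))) i) ^ 2 := by
    intro n
    rw [← Finset.sum_add_distrib]
    refine Finset.sum_congr rfl fun j _ => ?_
    have pythagoras := sum_sq_add_mulVec_of_transpose_mulVec_eq_zero hW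
      (transpose_mulVec_projection_residual hW hVW (q j - qbar)) (phat j - n (qhat j))
    simp only [Pi.sub_apply] at pythagoras ⊢
    rw [← pythagoras]
    refine Finset.sum_congr rfl fun i _ => ?_
    rw [mulVec_sub W, hphat j]
    simp only [Pi.add_apply, Pi.sub_apply]
    ring
  refine ⟨key, fun S R n _ => forall₂_congr fun n' _ => ?_⟩
  rw [key n, key n', add_right_comm, add_right_comm _ _ (R n'), add_le_add_iff_right]
end

section
/- Let N, r, m, M be positive natural numbers, let V ∈ ℝ^{N×r} and W ∈ ℝ^{N×m} be matrices satisfying VᵀV = I_r, WᵀW = I_m, and VᵀW = 0, let q̄ ∈ ℝ^N, and let q_1, …, q_M ∈ ℝ^N. Then for every function n : ℝ^r → ℝ^m, ∑_{j=1}^M ‖q_j − (q̄ + V Vᵀ(q_j − q̄) + W n(Vᵀ(q_j − q̄)))‖₂² ≥ ∑_{j=1}^M ‖(q_j − q̄) − V Vᵀ(q_j − q̄) − W Wᵀ(q_j − q̄)‖₂², with equality if and only if n(Vᵀ(q_j − q̄)) = Wᵀ(q_j − q̄) for every j = 1, …, M. -/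
open Matrix

/-- Pythagoras: a vector orthogonal to the range of a matrix with orthonormal columns. -/
theorem dotProduct_add_mulVec_self {ι κ : Type*} [Fintype ι] [Fintype κ] [DecidableEq κ]
    {W : Matrix ι κ ℝ} (hW : Wᵀ * W = 1) {e : ι → ℝ} (he : Wᵀ *ᵥ e = 0) (d : κ → ℝ) :
    (e + W *ᵥ d) ⬝ᵥ (e + W *ᵥ d) = e ⬝ᵥ e + d ⬝ᵥ d := by
  have hed : e ⬝ᵥ W *ᵥ d = 0 := by
    rw [dotProduct_mulVec, ← mulVec_transpose, he, zero_dotProduct]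
  have hdd : W *ᵥ d ⬝ᵥ W *ᵥ d = d ⬝ᵥ d := by
    rw [dotProduct_mulVec, ← mulVec_transpose, mulVec_mulVec, hW, one_mulVec]
  rw [add_dotProduct, dotProduct_add, dotProduct_add, dotProduct_comm (W *ᵥ d) e, hed, hdd]
  ring

/-- The residual of orthogonal projection onto the columns of `V` and `W` is orthogonal
to the columns of `W`. -/
theorem transpose_mulVec_residual {ι κ ρ : Type*} [Fintype ι] [Fintype κ] [Fintype ρ]
    [DecidableEq κ] {V : Matrix ι ρ ℝ} {W : Matrix ι κ ℝ}
    (hW : Wᵀ * W = 1) (hVW : Vᵀ * W = 0) (x : ι → ℝ) :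
    Wᵀ *ᵥ (x - V *ᵥ (Vᵀ *ᵥ x) - W *ᵥ (Wᵀ *ᵥ x)) = 0 := by
  have hWV : Wᵀ * V = 0 := by simpa using congrArg transpose hVW
  rw [mulVec_sub, mulVec_sub, mulVec_mulVec _ Wᵀ V, mulVec_mulVec _ Wᵀ W, hW, hWV]
  simp

/-- Replacing the coordinates `Wᵀ x` by `a` increases the squared residual by the squared
distance between them. -/
theorem sum_sq_residual_eq {ι κ ρ : Type*} [Fintype ι] [Fintype κ] [Fintype ρ]
    [DecidableEq κ] {V : Matrix ι ρ ℝ} {W : Matrix ι κ ℝ}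
    (hW : Wᵀ * W = 1) (hVW : Vᵀ * W = 0) (p y : ι → ℝ) (a : κ → ℝ) :
    ∑ i, (y i - (p + V *ᵥ (Vᵀ *ᵥ (y - p)) + W *ᵥ a) i) ^ 2
      = ∑ i, ((y - p) i - (V *ᵥ (Vᵀ *ᵥ (y - p))) i - (W *ᵥ (Wᵀ *ᵥ (y - p))) i) ^ 2
        + ∑ k, ((Wᵀ *ᵥ (y - p)) k - a k) ^ 2 := by
  have h := dotProduct_add_mulVec_self hW (transpose_mulVec_residual hW hVW (y - p))
    (Wᵀ *ᵥ (y - p) - a)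
  simp only [dotProduct, ← sq] at h
  refine Eq.trans (Finset.sum_congr rfl fun i _ => ?_) h
  simp only [mulVec_sub W, Pi.add_apply, Pi.sub_apply]
  ring

/-- The total squared projection error of the nonlinear-augmentation
encoder–decoder pair is bounded below by the total squared residual of
orthogonal projection onto the combined subspace, with equality iff the
nonlinear term reproduces the augmenting coordinates on the data. -/
theorem stmt2 (N r m M : ℕ) (hN : 0 < N) (hr : 0 < r) (hm : 0 < m) (hM : 0 < M)
    (V : Matrix (Fin N) (Fin r) ℝ) (W : Matrix (Fin N) (Fin m) ℝ)
    (hV : Vᵀ * V = 1) (hW : Wᵀ * W = 1) (hVW : Vᵀ * W = 0)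
    (qbar : Fin N → ℝ) (q : Fin M → Fin N → ℝ)
    (n : (Fin r → ℝ) → (Fin m → ℝ)) :
    (∑ j, ∑ i, (q j i - (qbar + V *ᵥ (Vᵀ *ᵥ (q j - qbar))
        + W *ᵥ n (Vᵀ *ᵥ (q j - qbar))) i) ^ 2
      ≥ ∑ j, ∑ i, ((q j - qbar) i - (V *ᵥ (Vᵀ *ᵥ (q j - qbar))) i
          - (W *ᵥ (Wᵀ *ᵥ (q j - qbar))) i) ^ 2)
    ∧ ((∑ j, ∑ i, (q j i - (qbar + V *ᵥ (Vᵀ *ᵥ (q j - qbar))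
          + W *ᵥ n (Vᵀ *ᵥ (q j - qbar))) i) ^ 2
        = ∑ j, ∑ i, ((q j - qbar) i - (V *ᵥ (Vᵀ *ᵥ (q j - qbar))) i
            - (W *ᵥ (Wᵀ *ᵥ (q j - qbar))) i) ^ 2)
        ↔ ∀ j, n (Vᵀ *ᵥ (q j - qbar)) = Wᵀ *ᵥ (q j - qbar)) := by
  simp only [sum_sq_residual_eq hW hVW, Finset.sum_add_distrib]
  have hnonneg : ∀ j, 0 ≤ ∑ k, ((Wᵀ *ᵥ (q j - qbar)) k - n (Vᵀ *ᵥ (q j - qbar)) k) ^ 2 :=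
    fun j => Finset.sum_nonneg fun k _ => sq_nonneg _
  refine ⟨le_add_of_nonneg_right (Finset.sum_nonneg fun j _ => hnonneg j), ?_⟩
  rw [add_eq_left, Finset.sum_eq_zero_iff_of_nonneg fun j _ => hnonneg j]
  refine ⟨fun h j => ?_, fun h j _ => by simp [h j]⟩
  have hj := (Finset.sum_eq_zero_iff_of_nonneg fun k _ => sq_nonneg _).1 (h j (Finset.mem_univ j))
  funext k
  exact (sub_eq_zero.1 (pow_eq_zero_iff two_ne_zero |>.1 (hj k (Finset.mem_univ k)))).symm
end

section
/- Let n and p be positive natural numbers, let K ∈ ℝ^{n×n} be a symmetric positive semidefinite matrix, let λ > 0, and let Y ∈ ℝ^{p×n}. Define Ω = (K + λ I_n)⁻¹ Yᵀ ∈ ℝ^{n×p} (the matrix K + λ I_n is invertible because it is positive definite). Then for every W ∈ ℝ^{n×p}, ‖Yᵀ − K Ω‖_F² + λ · trace(Ωᵀ K Ω) ≤ ‖Yᵀ − K W‖_F² + λ · trace(Wᵀ K W). That is, Ω minimizes the regularized empirical loss J(W) = ‖Yᵀ − K W‖_F² + λ · trace(Wᵀ K W) over all W ∈ ℝ^{n×p}.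 -/
open Matrix

namespace Matrix

variable {m n : Type*} [Fintype m] [Fintype n]

theorem sum_sum_sq_eq_trace_transpose_mul (A : Matrix m n ℝ) :
    ∑ i, ∑ j, A i j ^ 2 = trace (Aᵀ * A) := by
  rw [Finset.sum_comm]
  simp [trace, mul_apply, sq]

/-- When `Ω` solves the regularized normal equation `K Ω + c Ω = B`, the regularized loss at
`Ω + D` exceeds the loss at `Ω` by a quadratic form in `D`. -/
theorem regularizedLoss_add_eq {K : Matrix m m ℝ} (hK : Kᵀ = K) {c : ℝ} {B Ω : Matrix m n ℝ}
    (hΩ : K * Ω + c • Ω = B) (D : Matrix m n ℝ) :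
    (∑ i, ∑ j, (B - K * (Ω + D)) i j ^ 2) + c * trace ((Ω + D)ᵀ * K * (Ω + D)) =
      (∑ i, ∑ j, (B - K * Ω) i j ^ 2) + c * trace (Ωᵀ * K * Ω) +
        ((∑ i, ∑ j, (K * D) i j ^ 2) + c * trace (Dᵀ * K * D)) := by
  have hsymm : trace (Dᵀ * (K * Ω)) = trace (Ωᵀ * (K * D)) := by
    rw [← trace_transpose]
    simp [hK, Matrix.mul_assoc]
  have hres : B - K * Ω = c • Ω := by rw [← hΩ, add_sub_cancel_left]
  have hresD : B - K * (Ω + D) = c • Ω - K * D := by rw [Matrix.mul_add, ← sub_sub, hres]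
  rw [hres, hresD]
  simp only [sum_sum_sq_eq_trace_transpose_mul, transpose_sub, transpose_add, transpose_smul,
    transpose_mul, hK, Matrix.mul_add, Matrix.add_mul, Matrix.mul_sub, Matrix.sub_mul,
    Matrix.smul_mul, Matrix.mul_smul, trace_add, trace_sub, trace_smul, smul_eq_mul,
    Matrix.mul_assoc, hsymm]
  ring

end Matrix

/-- Finite-dimensional (coefficient-matrix) form of the Representer Theorem:
`Ω = (K + λ I)⁻¹ Yᵀ` minimizes the regularized empirical loss
`J(W) = ‖Yᵀ − K W‖_F² + λ · trace(Wᵀ K W)`. -/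
theorem stmt4 (n p : ℕ) (hn : 0 < n) (hp : 0 < p)
    (K : Matrix (Fin n) (Fin n) ℝ) (hK : K.PosSemidef)
    (lam : ℝ) (hlam : 0 < lam)
    (Y : Matrix (Fin p) (Fin n) ℝ)
    (Omega : Matrix (Fin n) (Fin p) ℝ)
    (hOmega : Omega = (K + lam • (1 : Matrix (Fin n) (Fin n) ℝ))⁻¹ * Yᵀ) :
    ∀ W : Matrix (Fin n) (Fin p) ℝ,
      (∑ i, ∑ j, ((Yᵀ - K * Omega) i j) ^ 2) + lam * trace (Omegaᵀ * K * Omega)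
        ≤ (∑ i, ∑ j, ((Yᵀ - K * W) i j) ^ 2) + lam * trace (Wᵀ * K * W) := by
  intro W
  have hpos : (K + lam • (1 : Matrix (Fin n) (Fin n) ℝ)).PosDef :=
    PosDef.posSemidef_add hK (PosDef.one.smul hlam)
  have hnormal : K * Omega + lam • Omega = Yᵀ := by
    have h := mul_nonsing_inv_cancel_left _ Yᵀ ((isUnit_iff_isUnit_det _).mp hpos.isUnit)
    rwa [← hOmega, Matrix.add_mul, Matrix.smul_mul, Matrix.one_mul] at h
  have hsymm : Kᵀ = K := by simpa using hK.isHermitian.eq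
  have htrace : 0 ≤ trace ((W - Omega)ᵀ * K * (W - Omega)) := by
    simpa using (hK.conjTranspose_mul_mul_same (W - Omega)).trace_nonneg
  rw [← add_sub_cancel Omega W, regularizedLoss_add_eq hsymm hnormal]
  exact le_add_of_nonneg_right (by positivity)
end

section
/- Let n and p be positive natural numbers, let K ∈ ℝ^{n×n} be a symmetric positive definite matrix, let λ ≥ 0, and let Y ∈ ℝ^{p×n}. Then the regularized empirical loss J(W) = ‖Yᵀ − K W‖_F² + λ · trace(Wᵀ K W) has a unique minimizer over W ∈ ℝ^{n×p}, namely Ω = (K + λ I_n)⁻¹ Yᵀ: for every W ≠ Ω, J(Ω) < J(W). -/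
open Matrix

/-- The sum of the squared entries of a real matrix `A` is `trace (Aᵀ * A)`. -/
theorem sum_sq_eq_trace_transpose_mul_self {m n : Type*} [Fintype m] [Fintype n]
    (A : Matrix m n ℝ) : ∑ i, ∑ j, (A i j) ^ 2 = trace (Aᵀ * A) := by
  rw [Finset.sum_comm]
  simp [trace, mul_apply, sq]

/-- If `(K + c I) Ω = B` with `K` symmetric, then the regularized least-squares loss at `Ω + D`
exceeds the loss at `Ω` by exactly `‖K D‖² + c * trace (Dᵀ K D)`. -/
theorem regularized_loss_add {m n : Type*} [Fintype m] [Fintype n] [DecidableEq m]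
    {K : Matrix m m ℝ} (hK : Kᵀ = K) {c : ℝ} {B Ω : Matrix m n ℝ}
    (hΩ : (K + c • (1 : Matrix m m ℝ)) * Ω = B) (D : Matrix m n ℝ) :
    (∑ i, ∑ j, ((B - K * (Ω + D)) i j) ^ 2) + c * trace ((Ω + D)ᵀ * K * (Ω + D)) =
      (∑ i, ∑ j, ((B - K * Ω) i j) ^ 2) + c * trace (Ωᵀ * K * Ω) +
        ((∑ i, ∑ j, ((K * D) i j) ^ 2) + c * trace (Dᵀ * K * D)) := by
  have residual : B - K * Ω = c • Ω := by
    rw [← hΩ, Matrix.add_mul, smul_mul, Matrix.one_mul, add_sub_cancel_left]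
  have residual_add : B - K * (Ω + D) = c • Ω - K * D := by
    rw [Matrix.mul_add, ← sub_sub, residual]
  have cross : trace (Dᵀ * (K * Ω)) = trace (Ωᵀ * (K * D)) := by
    rw [← trace_transpose]
    simp [transpose_mul, hK, Matrix.mul_assoc]
  rw [residual, residual_add]
  simp only [sum_sq_eq_trace_transpose_mul_self, transpose_sub, transpose_add, transpose_smul,
    transpose_mul, hK, Matrix.mul_add, Matrix.add_mul, Matrix.mul_sub, Matrix.sub_mul,
    smul_mul, Matrix.mul_smul, trace_add, trace_sub, trace_smul, smul_eq_mul,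
    Matrix.mul_assoc, cross]
  ring

/-- Uniqueness part of the finite-dimensional Representer Theorem: for a
strictly positive definite kernel matrix `K`, the regularized loss has the
unique minimizer `Ω = (K + λ I)⁻¹ Yᵀ`. -/
theorem stmt6 (n p : ℕ) (hn : 0 < n) (hp : 0 < p)
    (K : Matrix (Fin n) (Fin n) ℝ) (hK : K.PosDef)
    (lam : ℝ) (hlam : 0 ≤ lam)
    (Y : Matrix (Fin p) (Fin n) ℝ)
    (Omega : Matrix (Fin n) (Fin p) ℝ)
    (hOmega : Omega = (K + lam • (1 : Matrix (Fin n) (Fin n) ℝ))⁻¹ * Yᵀ) :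
    ∀ W : Matrix (Fin n) (Fin p) ℝ, W ≠ Omega →
      (∑ i, ∑ j, ((Yᵀ - K * Omega) i j) ^ 2) + lam * trace (Omegaᵀ * K * Omega)
        < (∑ i, ∑ j, ((Yᵀ - K * W) i j) ^ 2) + lam * trace (Wᵀ * K * W) := by
  intro W hW
  have hunit : IsUnit (K + lam • (1 : Matrix (Fin n) (Fin n) ℝ)) :=
    (hK.add_posSemidef (PosSemidef.one.smul hlam)).isUnit
  have hnormal : (K + lam • (1 : Matrix (Fin n) (Fin n) ℝ)) * Omega = Yᵀ := by
    rw [hOmega, mul_nonsing_inv_cancel_left _ _ ((isUnit_iff_isUnit_det _).mp hunit)]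
  have hsymm : Kᵀ = K := by simpa using hK.isHermitian.eq
  have hloss := regularized_loss_add hsymm hnormal (W - Omega)
  rw [add_sub_cancel] at hloss
  have hKD : K * (W - Omega) ≠ 0 := fun h => hW <| sub_eq_zero.mp <| by
    rw [← nonsing_inv_mul_cancel_left K (W - Omega) ((isUnit_iff_isUnit_det _).mp hK.isUnit), h,
      Matrix.mul_zero]
  have hsq : 0 < ∑ i, ∑ j, ((K * (W - Omega)) i j) ^ 2 := by
    refine lt_of_le_of_ne (by positivity) fun h => hKD ?_
    rw [sum_sq_eq_trace_transpose_mul_self, ← conjTranspose_eq_transpose_of_trivial] at h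
    exact trace_conjTranspose_mul_self_eq_zero_iff.mp h.symm
  have htrace : 0 ≤ trace ((W - Omega)ᵀ * K * (W - Omega)) := by
    simpa using (hK.posSemidef.conjTranspose_mul_mul_same (W - Omega)).trace_nonneg
  linarith [mul_nonneg hlam htrace]
end

section
/- Let N, r, m, M be positive natural numbers, let V ∈ ℝ^{N×r} and W ∈ ℝ^{N×m} be matrices satisfying VᵀV = I_r, WᵀW = I_m, and VᵀW = 0, let q̄ ∈ ℝ^N, let q_1, …, q_M ∈ ℝ^N, and set q̂_j = Vᵀ(q_j − q̄) and p̂_j = Wᵀ(q_j − q̄). Let κ : ℝ^r × ℝ^r → ℝ be symmetric with the M-by-M kernel matrix K, with entries K_{ij} = κ(q̂_i, q̂_j), symmetric positive semidefinite, and let λ > 0. Let P̂ ∈ ℝ^{m×M} be the matrix whose j-th column is p̂_j, and let Ω = (K + λ I_M)⁻¹ P̂ᵀ ∈ ℝ^{M×m}. For C ∈ ℝ^{M×m}, define the kernel-section function n_C : ℝ^r → ℝ^m by n_C(x) = Cᵀ (κ(q̂_1, x), …, κ(q̂_M, x))ᵀ. Then for every C ∈ ℝ^{M×m}, ∑_{j=1}^M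 ‖q_j − (q̄ + V Vᵀ(q_j − q̄) + W n_Ω(q̂_j))‖₂² + λ · trace(Ωᵀ K Ω) ≤ ∑_{j=1}^M ‖q_j − (q̄ + V Vᵀ(q_j − q̄) + W n_C(q̂_j))‖₂² + λ · trace(Cᵀ K C). -/
open Matrix

section RegularizedLeastSquares

variable {ι κ μ : Type*} [Fintype ι] [Fintype κ]

lemma sum_sum_sq_eq_trace_transpose_mul_self (X : Matrix ι κ ℝ) :
    ∑ j, ∑ i, X i j ^ 2 = trace (Xᵀ * X) := by
  simp [trace, mul_apply, sq]

/-- Completing the square in the regularized least-squares functional at a coefficient matrix `Ω`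
satisfying the normal equation `Wᵀ R = Ωᵀ K + c Ωᵀ`. -/
lemma trace_regularized_residual_add [Fintype μ] [DecidableEq μ] {W : Matrix ι μ ℝ}
    {R : Matrix ι κ ℝ} {K : Matrix κ κ ℝ} {Ω : Matrix κ μ ℝ} {c : ℝ} (hW : Wᵀ * W = 1) (hK : Kᵀ = K)
    (hΩ : Wᵀ * R = Ωᵀ * K + c • Ωᵀ) (Δ : Matrix κ μ ℝ) :
    trace ((R - W * ((Ω + Δ)ᵀ * K))ᵀ * (R - W * ((Ω + Δ)ᵀ * K)))
        + c * trace ((Ω + Δ)ᵀ * K * (Ω + Δ))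
      = trace ((R - W * (Ωᵀ * K))ᵀ * (R - W * (Ωᵀ * K))) + c * trace (Ωᵀ * K * Ω)
        + (trace ((Δᵀ * K)ᵀ * (Δᵀ * K)) + c * trace (Δᵀ * K * Δ)) := by
  set X := R - W * (Ωᵀ * K) with hX
  set Y := Δᵀ * K with hY
  have hsplit : R - W * ((Ω + Δ)ᵀ * K) = X - W * Y := by
    rw [hX, hY, transpose_add, Matrix.add_mul, Matrix.mul_add]
    abel
  have hWX : Wᵀ * X = c • Ωᵀ := by
    rw [hX, Matrix.mul_sub, hΩ, ← Matrix.mul_assoc, hW, Matrix.one_mul, add_sub_cancel_left]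
  have hYX : trace ((W * Y)ᵀ * X) = c * trace (Y * Ω) := by
    rw [transpose_mul, Matrix.mul_assoc, hWX, Matrix.mul_smul, trace_smul, smul_eq_mul,
      ← transpose_mul, trace_transpose, trace_mul_comm]
  have hXY : trace (Xᵀ * (W * Y)) = c * trace (Y * Ω) := by
    rw [← hYX, ← trace_transpose, transpose_mul, transpose_transpose]
  have hYY : (W * Y)ᵀ * (W * Y) = Yᵀ * Y := by
    rw [transpose_mul, Matrix.mul_assoc, ← Matrix.mul_assoc Wᵀ, hW, Matrix.one_mul]
  have hΩΔ : trace (Ωᵀ * K * Δ) = trace (Y * Ω) := by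
    rw [← trace_transpose, hY]
    simp only [transpose_mul, transpose_transpose, hK, Matrix.mul_assoc]
  rw [hsplit]
  simp only [transpose_sub, transpose_add, Matrix.sub_mul, Matrix.mul_sub, Matrix.add_mul,
    Matrix.mul_add, trace_sub, trace_add, hYX, hXY, hYY, hΩΔ, ← hY]
  ring

lemma trace_regularized_residual_le [Fintype μ] [DecidableEq μ] {W : Matrix ι μ ℝ}
    {R : Matrix ι κ ℝ} {K : Matrix κ κ ℝ} {Ω : Matrix κ μ ℝ} {c : ℝ} (hW : Wᵀ * W = 1) (hK : K.PosSemidef)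
    (hc : 0 ≤ c) (hΩ : Wᵀ * R = Ωᵀ * K + c • Ωᵀ) (C : Matrix κ μ ℝ) :
    trace ((R - W * (Ωᵀ * K))ᵀ * (R - W * (Ωᵀ * K))) + c * trace (Ωᵀ * K * Ω)
      ≤ trace ((R - W * (Cᵀ * K))ᵀ * (R - W * (Cᵀ * K))) + c * trace (Cᵀ * K * C) := by
  have hKt : Kᵀ = K := by simpa using hK.isHermitian.eq
  have key := trace_regularized_residual_add hW hKt hΩ (C - Ω)
  rw [add_sub_cancel] at key
  have hsq : 0 ≤ trace (((C - Ω)ᵀ * K)ᵀ * ((C - Ω)ᵀ * K)) := by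
    rw [← sum_sum_sq_eq_trace_transpose_mul_self]
    positivity
  have hreg : 0 ≤ trace ((C - Ω)ᵀ * K * (C - Ω)) := by
    simpa using (hK.conjTranspose_mul_mul_same (C - Ω)).trace_nonneg
  rw [key]
  exact le_add_of_nonneg_right (add_nonneg hsq (mul_nonneg hc hreg))

end RegularizedLeastSquares

/-- The regularized kernel coefficients `Ω = (K + c I)⁻¹ Pᵀ` satisfy the transposed normal
equation. -/
lemma eq_transpose_mul_add_smul_of_eq_inv_mul {κ μ : Type*} [Fintype κ] [DecidableEq κ]
    {K : Matrix κ κ ℝ} {P : Matrix μ κ ℝ} {Ω : Matrix κ μ ℝ} {c : ℝ} (hK : K.PosSemidef) (hc : 0 < c)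
    (hΩ : Ω = (K + c • (1 : Matrix κ κ ℝ))⁻¹ * Pᵀ) : P = Ωᵀ * K + c • Ωᵀ := by
  have hKt : Kᵀ = K := by simpa using hK.isHermitian.eq
  have hpd : (K + c • (1 : Matrix κ κ ℝ)).PosDef := PosDef.posSemidef_add hK (PosDef.one.smul hc)
  have hsolve : (K + c • (1 : Matrix κ κ ℝ)) * Ω = Pᵀ := by
    rw [hΩ, mul_nonsing_inv_cancel_left _ _ ((isUnit_iff_isUnit_det _).1 hpd.isUnit)]
  rw [← transpose_transpose P, ← hsolve]
  simp [Matrix.add_mul, transpose_mul, hKt]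

/-- The coefficient matrix `Ω = (K + λ I)⁻¹ P̂ᵀ` yields the kernel-section
nonlinear augmentation term minimizing the regularized total projection error
of the kernel-manifold decoder `g(q̂) = q̄ + V q̂ + W n(q̂)` over all
kernel-section functions `n_C(x) = Cᵀ (κ(q̂₁, x), …, κ(q̂_M, x))ᵀ`. -/
theorem stmt12 (N r m M : ℕ) (hN : 0 < N) (hr : 0 < r) (hm : 0 < m) (hM : 0 < M)
    (V : Matrix (Fin N) (Fin r) ℝ) (W : Matrix (Fin N) (Fin m) ℝ)
    (hV : Vᵀ * V = 1) (hW : Wᵀ * W = 1) (hVW : Vᵀ * W = 0)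
    (qbar : Fin N → ℝ) (q : Fin M → Fin N → ℝ)
    (qhat : Fin M → Fin r → ℝ) (phat : Fin M → Fin m → ℝ)
    (hqhat : ∀ j, qhat j = Vᵀ *ᵥ (q j - qbar))
    (hphat : ∀ j, phat j = Wᵀ *ᵥ (q j - qbar))
    (kappa : (Fin r → ℝ) → (Fin r → ℝ) → ℝ)
    (hkappa : ∀ a b, kappa a b = kappa b a)
    (K : Matrix (Fin M) (Fin M) ℝ)
    (hKdef : K = Matrix.of fun i j => kappa (qhat i) (qhat j))
    (hK : K.PosSemidef)
    (lam : ℝ) (hlam : 0 < lam)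
    (Phat : Matrix (Fin m) (Fin M) ℝ)
    (hPhat : ∀ i j, Phat i j = phat j i)
    (Omega : Matrix (Fin M) (Fin m) ℝ)
    (hOmega : Omega = (K + lam • (1 : Matrix (Fin M) (Fin M) ℝ))⁻¹ * Phatᵀ)
    (nC : Matrix (Fin M) (Fin m) ℝ → (Fin r → ℝ) → (Fin m → ℝ))
    (hnC : ∀ C x, nC C x = Cᵀ *ᵥ fun k => kappa (qhat k) x) :
    ∀ C : Matrix (Fin M) (Fin m) ℝ,
      (∑ j, ∑ i, (q j i - (qbar + V *ᵥ (Vᵀ *ᵥ (q j - qbar))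
            + W *ᵥ nC Omega (qhat j)) i) ^ 2)
          + lam * trace (Omegaᵀ * K * Omega)
        ≤ (∑ j, ∑ i, (q j i - (qbar + V *ᵥ (Vᵀ *ᵥ (q j - qbar))
            + W *ᵥ nC C (qhat j)) i) ^ 2)
          + lam * trace (Cᵀ * K * C) := by
  intro C
  set D : Matrix (Fin N) (Fin M) ℝ := of fun i j => (q j - qbar) i with hD
  have hWV : Wᵀ * V = 0 := by
    rw [← transpose_transpose V, ← transpose_mul, hVW, transpose_zero]
  have hP : Wᵀ * (D - V * (Vᵀ * D)) = Phat := by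
    rw [Matrix.mul_sub, ← Matrix.mul_assoc, hWV, Matrix.zero_mul, sub_zero]
    ext i j
    rw [hPhat, hphat]
    rfl
  have hresidual (B : Matrix (Fin M) (Fin m) ℝ) :
      ∑ j, ∑ i, (q j i - (qbar + V *ᵥ (Vᵀ *ᵥ (q j - qbar)) + W *ᵥ nC B (qhat j)) i) ^ 2
        = trace ((D - V * (Vᵀ * D) - W * (Bᵀ * K))ᵀ * (D - V * (Vᵀ * D) - W * (Bᵀ * K))) := by
    rw [← sum_sum_sq_eq_trace_transpose_mul_self]
    refine Finset.sum_congr rfl fun j _ => Finset.sum_congr rfl fun i _ => ?_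
    have hVD : (V * (Vᵀ * D)) i j = (V *ᵥ (Vᵀ *ᵥ (q j - qbar))) i := rfl
    have hWB : (W * (Bᵀ * K)) i j = (W *ᵥ nC B (qhat j)) i := by
      rw [hnC, hKdef]
      rfl
    rw [Matrix.sub_apply, Matrix.sub_apply, hVD, hWB]
    simp only [hD, of_apply, Pi.add_apply, Pi.sub_apply]
    ring
  rw [hresidual, hresidual]
  exact trace_regularized_residual_le hW hK hlam.le
    (hP.trans (eq_transpose_mul_add_smul_of_eq_inv_mul hK hlam hOmega)) C
end
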